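/- Let (R,𝔪) be a Cohen-Macaulay local ring with canonical module that is generically Gorenstein, let ω be a canonical ideal of R, and let x ∈ ω be an R-regular element. Then exactly one of the following holds: (1) X_{ω/ω²} ≅ X^{ω²/xω}; (2) X_{ω/ω²} ≅ ω ⊕ X^{ω²/xω}. Here X_M denotes the MCM part of the minimal MCM approximation of M and X^M the MCM part of the minimal FID hull of M. -/

import Mathlib

open CategoryTheory

noncomputable section

/-- The Ext module `Ext^n_R(M, N)` for `R`-modules `M`, `N`. -/
abbrev ModExt (R : Type) [CommRing R] (n : ℕ) (M N : ModuleCat R) : ModuleCat R :=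
  ((Ext R (ModuleCat R) n).obj (Opposite.op M)).obj N

/-- An `R`-module `M` has finite injective dimension if `Ext^i_R(-, M)` vanishes
for all `i` beyond some bound. -/
def HasFiniteInjDim (R : Type) [CommRing R] (M : ModuleCat R) : Prop :=
  ∃ n : ℕ, ∀ (N : ModuleCat R) (i : ℕ), n < i → Subsingleton (ModExt R i N M)

/-- The depth of a module over a local ring, via Rees' characterization:
the least `n` with `Ext^n(k, M) ≠ 0`. -/
def moduleDepth (R : Type) [CommRing R] [IsLocalRing R] (M : ModuleCat R) : ℕ∞ :=
  sInf {n : ℕ∞ | ∃ m : ℕ, n = (m : ℕ∞) ∧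
    Nontrivial (ModExt R m (ModuleCat.of R (IsLocalRing.ResidueField R)) M)}

/-- A Noetherian local ring is Cohen-Macaulay if its depth equals its Krull dimension. -/
def IsCMLocalRing (R : Type) [CommRing R] [IsLocalRing R] : Prop :=
  IsNoetherianRing R ∧
    (moduleDepth R (ModuleCat.of R R) : WithBot ℕ∞) = ringKrullDim R

/-- A maximal Cohen-Macaulay module: finitely generated with depth equal to `dim R`. -/
def IsMCM (R : Type) [CommRing R] [IsLocalRing R] (X : ModuleCat R) : Prop :=
  Module.Finite R X ∧ (moduleDepth R X : WithBot ℕ∞) = ringKrullDim R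

/-- A Cohen-Macaulay module of codimension one:
`depth M = dim M = dim R - 1`. -/
def IsCMofCodimOne (R : Type) [CommRing R] [IsLocalRing R] (M : ModuleCat R) : Prop :=
  Module.Finite R M ∧ ∃ d : ℕ, ringKrullDim R = ((d + 1 : ℕ) : WithBot ℕ∞) ∧
    moduleDepth R M = (d : ℕ∞) ∧
    ringKrullDim (R ⧸ Module.annihilator R M) = ((d : ℕ) : WithBot ℕ∞)

/-- A Gorenstein local ring: Noetherian local with finite injective dimension over itself. -/
def IsGorensteinLocalRing (A : Type) [CommRing A] : Prop :=
  IsNoetherianRing A ∧ IsLocalRing A ∧ HasFiniteInjDim A (ModuleCat.of A A)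

/-- `R` is generically Gorenstein if its localization at every minimal prime is Gorenstein. -/
def IsGenericallyGorenstein (R : Type) [CommRing R] : Prop :=
  ∀ p ∈ minimalPrimes R, ∀ h : p.IsPrime,
    letI := h
    IsGorensteinLocalRing (Localization.AtPrime p)

/-- A canonical module of a local ring `R`: finitely generated, of finite injective
dimension, with `Ext^i(k, ω) ≅ k` for `i = dim R` and `Ext^i(k, ω) = 0` otherwise. -/
def IsCanonicalModule (R : Type) [CommRing R] [IsLocalRing R] (W : ModuleCat R) : Prop :=
  Module.Finite R W ∧ HasFiniteInjDim R W ∧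
    ∃ d : ℕ, ringKrullDim R = (d : ℕ) ∧
      Nonempty ((ModExt R d (ModuleCat.of R (IsLocalRing.ResidueField R)) W) ≃ₗ[R]
        IsLocalRing.ResidueField R) ∧
      ∀ i : ℕ, i ≠ d →
        Subsingleton (ModExt R i (ModuleCat.of R (IsLocalRing.ResidueField R)) W)

/-- A canonical ideal: an ideal of `R` which, as an `R`-module, is a canonical module. -/
def IsCanonicalIdeal (R : Type) [CommRing R] [IsLocalRing R] (I : Ideal R) : Prop :=
  IsCanonicalModule R (ModuleCat.of R I)

/-- `Y` and `X` have a common nonzero direct summand via the map `ι : Y → X`. -/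
def HasCommonSummandVia (R : Type) [CommRing R] {Y X : ModuleCat R}
    (ι : Y →ₗ[R] X) : Prop :=
  ∃ (N Y' X' : ModuleCat.{0} R), Nontrivial N ∧
    ∃ (e : Y ≃ₗ[R] N × Y') (f : X ≃ₗ[R] N × X') (ι' : Y' →ₗ[R] X'),
      ∀ y : Y, f (ι y) = ((e y).1, ι' (e y).2)

/-- `0 → Y → X → M → 0` is an MCM approximation of `M`. -/
def IsMCMApprox (R : Type) [CommRing R] [IsLocalRing R] (M Y X : ModuleCat R)
    (ι : Y →ₗ[R] X) (π : X →ₗ[R] M) : Prop :=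
  Module.Finite R M ∧ Module.Finite R Y ∧ IsMCM R X ∧ HasFiniteInjDim R Y ∧
    Function.Injective ι ∧ Function.Surjective π ∧ Function.Exact ι π

/-- `0 → Y → X → M → 0` is a minimal MCM approximation of `M`. -/
def IsMinMCMApprox (R : Type) [CommRing R] [IsLocalRing R] (M Y X : ModuleCat R)
    (ι : Y →ₗ[R] X) (π : X →ₗ[R] M) : Prop :=
  IsMCMApprox R M Y X ι π ∧ ¬ HasCommonSummandVia R ι

/-- `0 → M → Y → X → 0` is an FID hull of `M`. -/
def IsFIDHull (R : Type) [CommRing R] [IsLocalRing R] (M Y X : ModuleCat R)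
    (ι : M →ₗ[R] Y) (π : Y →ₗ[R] X) : Prop :=
  Module.Finite R M ∧ Module.Finite R Y ∧ HasFiniteInjDim R Y ∧
    (IsMCM R X ∨ Subsingleton X) ∧
    Function.Injective ι ∧ Function.Surjective π ∧ Function.Exact ι π

/-- `0 → M → Y → X → 0` is a minimal FID hull of `M`. -/
def IsMinFIDHull (R : Type) [CommRing R] [IsLocalRing R] (M Y X : ModuleCat R)
    (ι : M →ₗ[R] Y) (π : Y →ₗ[R] X) : Prop :=
  IsFIDHull R M Y X ι π ∧ ¬ HasCommonSummandVia R π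

/-- The free rank of a module: the largest `m` with `R^m` a direct summand. -/
def freeRank (R : Type) [CommRing R] (X : ModuleCat R) : ℕ∞ :=
  sSup {n : ℕ∞ | ∃ m : ℕ, n = (m : ℕ∞) ∧
    ∃ X' : ModuleCat.{0} R, Nonempty (X ≃ₗ[R] ((Fin m → R) × X'))}

/-- The `W`-rank of a module: the largest `m` with `W^m` a direct summand. -/
def wRank (R : Type) [CommRing R] (W X : ModuleCat R) : ℕ∞ :=
  sSup {n : ℕ∞ | ∃ m : ℕ, n = (m : ℕ∞) ∧
    ∃ X' : ModuleCat.{0} R, Nonempty (X ≃ₗ[R] ((Fin m → W) × X'))}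

/-- `M` and `N` are `W`-stably isomorphic. -/
def WStablyIso (R : Type) [CommRing R] (W M N : ModuleCat R) : Prop :=
  ∃ s t : ℕ, Nonempty ((M × (Fin s → W)) ≃ₗ[R] (N × (Fin t → W)))

/-- The quotient module `I/J` (realized as `I` modulo the elements of `J` lying in `I`). -/
abbrev qmod (R : Type) [CommRing R] (I J : Ideal R) : ModuleCat R :=
  ModuleCat.of R (I ⧸ (Submodule.comap I.subtype J))

namespace CategoryTheory.ProjectiveResolution
universe w v u
variable {C : Type u} [Category.{v} C] [Abelian C] [HasExt.{w} C] {X Y : C}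
  (P : ProjectiveResolution X)
open CochainComplex HomComplex

lemma extMk_zero_eq_zero_iff (f : P.complex.X 0 ⟶ Y) (hf : P.complex.d 1 0 ≫ f = 0) :
    P.extMk f 1 rfl hf = 0 ↔ f = 0 := by
  refine ⟨fun h => ?_, fun h => by subst h; exact P.extMk_zero 1 rfl⟩
  simp only [← P.extEquivCohomologyClass.apply_eq_iff_eq,
    extEquivCohomologyClass_extMk, extEquivCohomologyClass_zero,
    CohomologyClass.mk_eq_zero_iff] at h
  rw [Cocycle.toSingleMk_mem_coboundaries_iff _ _ _ _ _ 1 (by simp)] at h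
  obtain ⟨g, hg⟩ := h
  have h0 : P.cochainComplex.d (-(0 : ℕ) : ℤ) 1 = 0 :=
    (P.cochainComplex.isZero_of_isStrictlyLE 0 1).eq_of_tgt _ _
  rw [h0, Limits.zero_comp] at hg
  rw [← cancel_epi (P.cochainComplexXIso (-(0:ℕ)) 0 rfl).hom]
  simpa using hg.symm

lemma extMk_eq_zero_iff_exists (n : ℕ) (f : P.complex.X n ⟶ Y)
    (hf : P.complex.d (n + 1) n ≫ f = 0) : P.extMk f (n + 1) rfl hf = 0 ↔
      ∃ g : P.complex.X ((ComplexShape.up ℕ).prev n) ⟶ Y, P.complex.d n _ ≫ g = f := by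
  rcases n with _ | n
  · rw [extMk_zero_eq_zero_iff, CochainComplex.prev_nat_zero, P.complex.shape 0 0 (by simp)]
    simp [eq_comm]
  · rw [P.extMk_eq_zero_iff f _ rfl hf n rfl, CochainComplex.prev_nat_succ]

end CategoryTheory.ProjectiveResolution

lemma nonempty_modExt_equiv {R : Type} [CommRing R] (n : ℕ) (M N : ModuleCat R) :
    Nonempty (ModExt R n M N ≃ₗ[R] Abelian.Ext M N n) := by
  let P := projectiveResolution M
  let S : ShortComplex (ModuleCat R) := ShortComplex.moduleCatMk
    (Linear.leftComp R N (P.complex.d n ((ComplexShape.up ℕ).prev n)))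
    (Linear.leftComp R N (P.complex.d ((ComplexShape.up ℕ).next n) n)) (by ext; simp)
  let e : ModExt R n M N ≃ₗ[R] S.homology := (P.isoExt n N).toLinearEquiv
  have hg : ∀ f : P.complex.X n ⟶ N, f ∈ LinearMap.ker S.g.hom ↔ P.complex.d (n + 1) n ≫ f = 0 := by
    intro f
    have : (ComplexShape.up ℕ).next n = n + 1 := CochainComplex.next _ _
    rw [← this]
    rfl
  have smul : ∀ (r : R) (f : P.complex.X n ⟶ N) (hf : P.complex.d (n + 1) n ≫ f = 0),
      P.extMk (r • f) (n + 1) rfl (by simp [hf]) = r • P.extMk f (n + 1) rfl hf := by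
    intro r f hf
    rw [Abelian.Ext.smul_eq_comp_mk₀, P.extMk_comp_mk₀]
    simp
  let φ : LinearMap.ker S.g.hom →ₗ[R] Abelian.Ext M N n :=
    { toFun z := P.extMk z.1 (n + 1) rfl ((hg z.1).1 z.2)
      map_add' a b := (P.add_extMk _ _ _ _ _ _).symm
      map_smul' r a := smul r _ _ }
  have hφ : Function.Surjective φ := fun u => by
    obtain ⟨f, hf, rfl⟩ := P.extMk_surjective u (n + 1) rfl
    exact ⟨⟨f, (hg f).2 hf⟩, rfl⟩
  have hker : LinearMap.ker φ = LinearMap.range S.moduleCatToCycles := by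
    ext z
    refine (P.extMk_eq_zero_iff_exists n z.1 ((hg z.1).1 z.2)).trans ?_
    exact exists_congr fun g => ⟨fun h => Subtype.ext h, fun h => congrArg Subtype.val h⟩
  exact ⟨e ≪≫ₗ S.moduleCatHomologyIso.toLinearEquiv ≪≫ₗ
    Submodule.quotEquivOfEq _ _ hker.symm ≪≫ₗ φ.quotKerEquivOfSurjective hφ⟩

section

open IsLocalRing

section ExtVanishing

variable {R : Type} [CommRing R]

/-- `Ext^i(-, Y)` vanishes on finitely generated modules for `i > n`. -/
def InjDimLE (n : ℕ) (Y : ModuleCat.{0} R) : Prop :=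
  ∀ (M : ModuleCat.{0} R) [Module.Finite R M] (i : ℕ), n < i → ∀ e : Abelian.Ext M Y i, e = 0

/-- `Ext^l(k, N)` vanishes for `l < d`. -/
def DepthGE [IsLocalRing R] (d : ℕ) (N : ModuleCat.{0} R) : Prop :=
  ∀ l < d, ∀ e : Abelian.Ext (ModuleCat.of R (ResidueField R)) N l, e = 0

lemma eq_zero_of_forall_exists_smul [IsLocalRing R] {E : Type*} [AddCommGroup E] [Module R E]
    [Module.Finite R E] {x : R} (hx : x ∈ maximalIdeal R) (h : ∀ e : E, ∃ e', e = x • e') (e : E) :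
    e = 0 := by
  have := Submodule.eq_bot_of_le_smul_of_le_jacobson_bot (maximalIdeal R) (⊤ : Submodule R E)
    Module.Finite.fg_top (fun e _ => by
      obtain ⟨e', rfl⟩ := h e
      exact Submodule.smul_mem_smul hx trivial) (maximalIdeal_le_jacobson _)
  exact (Submodule.mem_bot R).1 (this ▸ Submodule.mem_top)

lemma ext_smul_eq_zero {M N : ModuleCat.{0} R} {r : R} (hr : ∀ m : M, r • m = 0) {i : ℕ}
    (e : Abelian.Ext M N i) : r • e = 0 := by
  have h0 : r • 𝟙 M = 0 := by
    ext m
    exact hr m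
  rw [← Abelian.Ext.mk₀_id_comp e, ← Abelian.Ext.smul_comp, ← Abelian.Ext.mk₀_smul, h0,
    Abelian.Ext.mk₀_zero, Abelian.Ext.zero_comp]

lemma smul_residueField_eq_zero [IsLocalRing R] {r : R} (hr : r ∈ maximalIdeal R)
    (m : ResidueField R) : r • m = 0 := by
  rw [Algebra.smul_def, ResidueField.algebraMap_eq, (residue_eq_zero_iff r).2 hr, zero_mul]

lemma smul_ext_residueField [IsLocalRing R] {r : R} (hr : r ∈ maximalIdeal R)
    {N : ModuleCat.{0} R} {i : ℕ} (e : Abelian.Ext (ModuleCat.of R (ResidueField R)) N i) :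
    r • e = 0 :=
  ext_smul_eq_zero (fun m => smul_residueField_eq_zero hr m) e

instance [IsLocalRing R] : Module.Finite R (ResidueField R) :=
  Module.Finite.of_surjective (Algebra.linearMap R (ResidueField R)) residue_surjective

lemma DepthGE.exists_isSMulRegular [IsNoetherianRing R] [IsLocalRing R] {j : ℕ}
    {N : ModuleCat.{0} R} [Module.Finite R N] (h : DepthGE (j + 1) N) :
    ∃ x ∈ maximalIdeal R, IsSMulRegular N x := by
  have : Subsingleton (ResidueField R →ₗ[R] N) := by
    refine ⟨fun f g => ?_⟩
    have h0 := h 0 (Nat.succ_pos _) (Abelian.Ext.mk₀ (ModuleCat.ofHom (f - g)))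
    rw [Abelian.Ext.mk₀_eq_zero_iff] at h0
    have := congrArg ModuleCat.Hom.hom h0
    exact sub_eq_zero.1 (by simpa using this)
  obtain ⟨x, hx, hreg⟩ := IsSMulRegular.subsingleton_linearMap_iff.1 this
  refine ⟨x, ?_, hreg⟩
  have := Module.mem_annihilator.1 hx (1 : ResidueField R)
  rw [Algebra.smul_def, mul_one, ResidueField.algebraMap_eq, residue_eq_zero_iff] at this
  exact this

section SMulRegular

variable {N : ModuleCat.{0} R} {x : R}

/-- The complex `N → N → N / xN`, with first map multiplication by `x`. -/
abbrev smulComplex (N : ModuleCat.{0} R) (x : R) : ShortComplex (ModuleCat.{0} R) :=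
  ShortComplex.mk (X₃ := ModuleCat.of R (QuotSMulTop x N)) (x • 𝟙 N)
    (ModuleCat.ofHom (Submodule.mkQ _)) (by
      ext n
      exact (Submodule.Quotient.mk_eq_zero _).2 (Submodule.smul_mem_pointwise_smul n x ⊤ trivial))

lemma smulComplex_shortExact (hx : IsSMulRegular N x) : (smulComplex N x).ShortExact :=
  hx.smulShortComplex_shortExact

lemma exists_eq_smul_of_ext_quotient_eq_zero (hx : IsSMulRegular N x) {Y : ModuleCat.{0} R} {i : ℕ}
    (h : ∀ e : Abelian.Ext (ModuleCat.of R (QuotSMulTop x N)) Y (i + 1), e = 0)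
    (e : Abelian.Ext N Y i) : ∃ e', e = x • e' := by
  obtain ⟨e', he'⟩ := Abelian.Ext.contravariant_sequence_exact₁ (smulComplex_shortExact hx) Y
    (n₁ := i + 1) e (add_comm 1 i) (h _)
  refine ⟨e', ?_⟩
  rw [Abelian.Ext.mk₀_smul, Abelian.Ext.smul_comp, Abelian.Ext.mk₀_id_comp] at he'
  exact he'.symm

lemma ext_eq_zero_of_ext_quotient_eq_zero [IsNoetherianRing R] [IsLocalRing R] [Module.Finite R N]
    (hx : IsSMulRegular N x) (hxm : x ∈ maximalIdeal R) {Y : ModuleCat.{0} R}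
    [Module.Finite R Y] {i : ℕ}
    (h : ∀ e : Abelian.Ext (ModuleCat.of R (QuotSMulTop x N)) Y (i + 1), e = 0)
    (e : Abelian.Ext N Y i) : e = 0 :=
  eq_zero_of_forall_exists_smul hxm (exists_eq_smul_of_ext_quotient_eq_zero hx h) e

lemma DepthGE.quotient [IsLocalRing R] (hx : IsSMulRegular N x) {j : ℕ} (h : DepthGE (j + 1) N) :
    DepthGE j (ModuleCat.of R (QuotSMulTop x N)) := fun l hl e => by
  obtain ⟨e', rfl⟩ := Abelian.Ext.covariant_sequence_exact₃ _ (smulComplex_shortExact hx)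
    e rfl (h _ (by omega) _)
  rw [h l (by omega) e', Abelian.Ext.zero_comp]

lemma exists_ext_quotient_comp_extClass [IsLocalRing R] (hx : IsSMulRegular N x)
    (hxm : x ∈ maximalIdeal R) {j : ℕ}
    (e : Abelian.Ext (ModuleCat.of R (ResidueField R)) N (j + 1)) :
    ∃ e' : Abelian.Ext (ModuleCat.of R (ResidueField R)) (ModuleCat.of R (QuotSMulTop x N)) j,
      e'.comp (smulComplex_shortExact hx).extClass rfl = e := by
  refine Abelian.Ext.covariant_sequence_exact₁ _ (smulComplex_shortExact hx) e ?_ rfl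
  rw [Abelian.Ext.mk₀_smul, Abelian.Ext.comp_smul, Abelian.Ext.comp_mk₀_id]
  exact smul_ext_residueField hxm _

end SMulRegular

lemma InjDimLE.mono {n m : ℕ} (h : n ≤ m) {Y : ModuleCat.{0} R} (hY : InjDimLE n Y) :
    InjDimLE m Y :=
  fun M _ i hi e => hY M i (h.trans_lt hi) e

lemma shortExact_of_exact {A B C : ModuleCat.{0} R} (f : A →ₗ[R] B) (g : B →ₗ[R] C)
    (hf : Function.Injective f) (hg : Function.Surjective g) (h : Function.Exact f g) :
    (ShortComplex.mk (ModuleCat.ofHom f) (ModuleCat.ofHom g) (by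
      ext a; exact h.apply_apply_eq_zero a)).ShortExact :=
  ModuleCat.shortComplex_shortExact _ h hf hg

instance isSimpleModule_residueField [IsLocalRing R] : IsSimpleModule R (ResidueField R) :=
  isSimpleModule_iff_quot_maximal.2 ⟨maximalIdeal R, inferInstance, ⟨LinearEquiv.refl R _⟩⟩

section Local

variable [IsLocalRing R] [IsNoetherianRing R]

/-- Dévissage for finitely generated modules over a Noetherian local ring. -/
lemma finite_induction_residueField {P : ModuleCat.{0} R → Prop}
    (regular : ∀ (M : ModuleCat.{0} R) [Module.Finite R M] (x : R), x ∈ maximalIdeal R →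
      IsSMulRegular M x → P M)
    (residue : P (ModuleCat.of R (ResidueField R)))
    (exact : ∀ S : ShortComplex (ModuleCat.{0} R), S.ShortExact → Module.Finite R S.X₃ →
      P S.X₁ → P S.X₃ → P S.X₂)
    (M : ModuleCat.{0} R) [hM : Module.Finite R M] : P M := by
  have sub (N : Type) [AddCommGroup N] [Module R N] [Subsingleton N] : P (ModuleCat.of R N) :=
    regular (ModuleCat.of R N) 0 (zero_mem _) (fun a b _ => Subsingleton.elim (α := N) a b)
  have equiv {N₁ N₂ : ModuleCat.{0} R} (e : N₁ ≃ₗ[R] N₂) (h : P N₁) : P N₂ :=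
    exact _ (shortExact_of_exact (C := ModuleCat.of R PUnit) e.toLinearMap 0 e.injective
      (Function.surjective_to_subsingleton _)
      ((e.exact_zero_iff_surjective _).2 e.surjective))
      (inferInstanceAs (Module.Finite R PUnit)) h (sub _)
  refine IsNoetherianRing.induction_on_isQuotientEquivQuotientPrime R hM
    (motive := fun N _ _ _ => P (ModuleCat.of R N)) (fun N _ _ _ _ => sub N) ?_ ?_
  · intro N _ _ _ p e
    by_cases hp : p.1 = maximalIdeal R
    · refine equiv (N₁ := ModuleCat.of R (ResidueField R)) ?_ residue
      exact (Submodule.quotEquivOfEq _ _ hp.symm).trans e.symm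
    · obtain ⟨x, hx, hxp⟩ := SetLike.exists_of_lt ((le_maximalIdeal p.2.ne_top).lt_of_ne hp)
      refine regular (ModuleCat.of R N) x hx ?_
      rw [isSMulRegular_iff_right_eq_zero_of_smul]
      intro n hn
      obtain ⟨r, hr⟩ := Ideal.Quotient.mk_surjective (e n)
      have h0 : x • e n = 0 := by rw [← map_smul, hn, map_zero]
      rw [← hr] at h0
      have : Ideal.Quotient.mk p.1 (x * r) = 0 := h0
      rw [Ideal.Quotient.eq_zero_iff_mem] at this
      have h1 : Ideal.Quotient.mk p.1 r = 0 :=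
        Ideal.Quotient.eq_zero_iff_mem.2 ((p.2.mem_or_mem this).resolve_left hxp)
      rw [h1] at hr
      exact e.map_eq_zero_iff.1 hr.symm
  · intro N₁ _ _ _ N₂ _ _ _ N₃ _ _ _ f g hf hg hfg h₁ h₃
    exact exact _ (shortExact_of_exact (A := ModuleCat.of R N₁) (B := ModuleCat.of R N₂)
      (C := ModuleCat.of R N₃) f g hf hg hfg) ‹Module.Finite R N₃› h₁ h₃

lemma InjDimLE.of_residueField {n r : ℕ} {Y : ModuleCat.{0} R} [Module.Finite R Y]
    (hY : InjDimLE n Y)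
    (h : ∀ i > r, ∀ e : Abelian.Ext (ModuleCat.of R (ResidueField R)) Y i, e = 0) :
    InjDimLE r Y := by
  have key (j : ℕ) : ∀ i > r, n < i + j → ∀ (M : ModuleCat.{0} R) [Module.Finite R M],
      ∀ e : Abelian.Ext M Y i, e = 0 := by
    induction j with
    | zero => exact fun i _ hi M _ e => hY M i hi e
    | succ j ih =>
      intro i hi hij M hM
      induction M using finite_induction_residueField with
      | regular M x hxm hx =>
        exact ext_eq_zero_of_ext_quotient_eq_zero hx hxm
          (ih (i + 1) (by omega) (by omega) (ModuleCat.of R (QuotSMulTop x M)))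
      | residue => exact h i hi
      | exact S hS _ h₁ h₃ =>
        intro e
        obtain ⟨e', rfl⟩ := Abelian.Ext.contravariant_sequence_exact₂ hS Y e (h₁ _)
        rw [h₃ e', Abelian.Ext.comp_zero]
  exact fun M _ i hi e => key (n + 1) i hi (by omega) M e

lemma InjDimLE.ext_eq_zero {r : ℕ} {Y : ModuleCat.{0} R} [Module.Finite R Y] (hY : InjDimLE r Y)
    {j : ℕ} {N : ModuleCat.{0} R} [Module.Finite R N] (hN : DepthGE j N) {i : ℕ} (hij : r < i + j)
    (e : Abelian.Ext N Y i) : e = 0 := by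
  induction j generalizing N i with
  | zero => exact hY N i hij e
  | succ j ih =>
    obtain ⟨x, hxm, hx⟩ := hN.exists_isSMulRegular
    exact ext_eq_zero_of_ext_quotient_eq_zero hx hxm
      (ih (N := ModuleCat.of R (QuotSMulTop x N)) (hN.quotient hx) (by omega)) e

/-- A universal class in `Ext^j(k, N)`, `j = depth N`. -/
lemma exists_ext_comp_eq {j : ℕ} {N : ModuleCat.{0} R} [Module.Finite R N] (hN : DepthGE j N)
    (e₀ : Abelian.Ext (ModuleCat.of R (ResidueField R)) N j) (he₀ : e₀ ≠ 0) :
    ∃ c : Abelian.Ext (ModuleCat.of R (ResidueField R)) N j,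
      ∀ (r i : ℕ) (hr : j + i = r) (Y : ModuleCat.{0} R) [Module.Finite R Y], InjDimLE r Y →
        ∀ u : Abelian.Ext (ModuleCat.of R (ResidueField R)) Y r,
          ∃ h : Abelian.Ext N Y i, c.comp h hr = u := by
  induction j generalizing N with
  | zero =>
    obtain ⟨f, rfl⟩ := (Abelian.Ext.mk₀_bijective _ _).2 e₀
    have hf : f.hom ≠ 0 := fun h => he₀ (by
      rw [Abelian.Ext.mk₀_eq_zero_iff]
      ext1
      exact h)
    let S := shortExact_of_exact (C := ModuleCat.of R (N ⧸ LinearMap.range f.hom)) f.hom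
      (Submodule.mkQ _) ((LinearMap.injective_or_eq_zero f.hom).resolve_right hf) (Submodule.mkQ_surjective _)
      (LinearMap.exact_map_mkQ_range _)
    refine ⟨Abelian.Ext.mk₀ f, fun r i hr Y _ hY u => ?_⟩
    obtain rfl : i = r := by omega
    exact Abelian.Ext.contravariant_sequence_exact₁ S Y u (add_comm 1 i)
      (hY (ModuleCat.of R (N ⧸ LinearMap.range f.hom)) (i + 1) (by omega) _)
  | succ j ih =>
    obtain ⟨x, hxm, hx⟩ := hN.exists_isSMulRegular
    obtain ⟨e', rfl⟩ := exists_ext_quotient_comp_extClass hx hxm e₀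
    obtain ⟨c, hc⟩ := ih (N := ModuleCat.of R (QuotSMulTop x N)) (hN.quotient hx) e'
      (fun h => he₀ (by rw [h, Abelian.Ext.zero_comp]))
    refine ⟨c.comp (smulComplex_shortExact hx).extClass rfl, fun r i hr Y _ hY u => ?_⟩
    obtain ⟨h', rfl⟩ := hc r (i + 1) (by omega) Y hY u
    obtain ⟨h, rfl⟩ := Abelian.Ext.contravariant_sequence_exact₃ (smulComplex_shortExact hx) Y h'
      (hY.ext_eq_zero hN (by omega) _) (add_comm 1 i)
    exact ⟨h, Abelian.Ext.comp_assoc _ _ _ _ _ (by omega)⟩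

/-- Bass: finite injective dimension is bounded by the depth of the ring. -/
lemma InjDimLE.le_depth {d n : ℕ} (hd : DepthGE d (ModuleCat.of R R))
    {e₀ : Abelian.Ext (ModuleCat.of R (ResidueField R)) (ModuleCat.of R R) d} (he₀ : e₀ ≠ 0)
    {Y : ModuleCat.{0} R} [Module.Finite R Y] (hY : InjDimLE n Y) : InjDimLE d Y := by
  obtain ⟨c, hc⟩ := exists_ext_comp_eq hd e₀ he₀
  have key (s : ℕ) (hs : InjDimLE (d + s) Y) : InjDimLE d Y := by
    induction s with
    | zero => exact hs
    | succ s ih =>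
      refine ih (hs.of_residueField fun i hi e => ?_)
      obtain hi' | rfl := (Nat.succ_le_of_lt hi).lt_or_eq
      · exact hs _ _ hi' e
      · obtain ⟨h, rfl⟩ := hc _ (s + 1) (by omega) Y hs e
        rw [Abelian.Ext.eq_zero_of_projective h, Abelian.Ext.comp_zero]
  exact key n (hY.mono (Nat.le_add_left _ _))

section Surjective

variable {d : ℕ} {W Y : ModuleCat.{0} R} [Module.Finite R Y] (hW : InjDimLE d W)
  (hY : InjDimLE d Y) (t : W ⟶ Y)
  (ht : ∀ u : Abelian.Ext (ModuleCat.of R (ResidueField R)) Y d,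
    ∃ v : Abelian.Ext (ModuleCat.of R (ResidueField R)) W d,
      v.comp (Abelian.Ext.mk₀ t) (add_zero d) = u)

include hW hY ht in
lemma exists_ext_top_comp_eq (M : ModuleCat.{0} R) [hM : Module.Finite R M]
    (u : Abelian.Ext M Y d) :
    ∃ v : Abelian.Ext M W d, v.comp (Abelian.Ext.mk₀ t) (add_zero d) = u := by
  induction M using finite_induction_residueField with
  | regular M x hxm hx =>
    refine ⟨0, ?_⟩
    rw [Abelian.Ext.zero_comp]
    exact (ext_eq_zero_of_ext_quotient_eq_zero hx hxm
      (hY (ModuleCat.of R (QuotSMulTop x M)) (d + 1) (by omega)) u).symm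
  | residue => exact ht u
  | exact S hS _ h₁ h₃ =>
    obtain ⟨v', hv'⟩ := h₁ ((Abelian.Ext.mk₀ S.f).comp u (zero_add d))
    obtain ⟨v, rfl⟩ := Abelian.Ext.contravariant_sequence_exact₁ hS W v' (add_comm 1 d)
      (hW _ _ (by omega) _)
    have h0 : (Abelian.Ext.mk₀ S.f).comp
        (u - v.comp (Abelian.Ext.mk₀ t) (add_zero d)) (zero_add d) = 0 := by
      rw [sub_eq_add_neg, Abelian.Ext.comp_add, Abelian.Ext.comp_neg, ← sub_eq_add_neg, ← hv', sub_eq_zero,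
        Abelian.Ext.comp_assoc_of_third_deg_zero]
    obtain ⟨u'', hu''⟩ := Abelian.Ext.contravariant_sequence_exact₂ hS Y _ h0
    obtain ⟨v'', rfl⟩ := h₃ u''
    refine ⟨(Abelian.Ext.mk₀ S.g).comp v'' (zero_add d) + v, ?_⟩
    rw [Abelian.Ext.add_comp, Abelian.Ext.comp_assoc_of_third_deg_zero, hu'', sub_add_cancel]

include hW hY ht in
lemma exists_ext_comp_mk₀_eq [Module.Finite R W] {i j : ℕ} (hij : i + j = d) (N : ModuleCat.{0} R)
    [Module.Finite R N] (hN : DepthGE j N) (u : Abelian.Ext N Y i) :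
    ∃ v : Abelian.Ext N W i, v.comp (Abelian.Ext.mk₀ t) (add_zero i) = u := by
  induction j generalizing N i with
  | zero =>
    obtain rfl : i = d := by omega
    exact exists_ext_top_comp_eq hW hY t ht N u
  | succ j ih =>
    obtain ⟨x, hxm, hx⟩ := hN.exists_isSMulRegular
    let S := smulComplex_shortExact hx
    let T := Abelian.Ext.postcompOfLinear (Abelian.Ext.mk₀ t) R N (add_zero i)
    suffices h : ∀ e : Abelian.Ext N Y i ⧸ LinearMap.range T, e = 0 by
      obtain ⟨v, hv⟩ := (Submodule.Quotient.mk_eq_zero _).1 (h (Submodule.Quotient.mk u))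
      exact ⟨v, hv⟩
    refine eq_zero_of_forall_exists_smul hxm fun e => ?_
    obtain ⟨u, rfl⟩ := Submodule.Quotient.mk_surjective _ e
    obtain ⟨v', hv'⟩ := ih (i := i + 1) (by omega) (ModuleCat.of R (QuotSMulTop x N))
      (hN.quotient hx) (S.extClass.comp u (add_comm 1 i))
    obtain ⟨v, rfl⟩ := Abelian.Ext.contravariant_sequence_exact₃ S W v'
      (hW.ext_eq_zero hN (by omega) _) (add_comm 1 i)
    have h0 : S.extClass.comp (u - v.comp (Abelian.Ext.mk₀ t) (add_zero i)) (add_comm 1 i) = 0 := by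
      rw [sub_eq_add_neg, Abelian.Ext.comp_add, Abelian.Ext.comp_neg, ← sub_eq_add_neg, ← hv',
        sub_eq_zero, Abelian.Ext.comp_assoc_of_third_deg_zero]
    obtain ⟨u', hu'⟩ := Abelian.Ext.contravariant_sequence_exact₁ S Y _ (add_comm 1 i) h0
    rw [Abelian.Ext.mk₀_smul, Abelian.Ext.smul_comp, Abelian.Ext.mk₀_id_comp] at hu'
    refine ⟨Submodule.Quotient.mk u', ?_⟩
    rw [← Submodule.Quotient.mk_smul, hu', Submodule.Quotient.eq]
    exact ⟨v, (sub_sub_cancel _ _).symm⟩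

include hW hY ht in
lemma surjective_of_ext_residueField [Module.Finite R W] (hd : DepthGE d (ModuleCat.of R R)) :
    Function.Surjective t := by
  intro y
  obtain ⟨v, hv⟩ := exists_ext_comp_mk₀_eq hW hY t ht (zero_add d) (ModuleCat.of R R) hd
    (Abelian.Ext.mk₀ (ModuleCat.ofHom (LinearMap.toSpanSingleton R Y y)))
  obtain ⟨f, rfl⟩ := (Abelian.Ext.mk₀_bijective _ _).2 v
  rw [Abelian.Ext.mk₀_comp_mk₀] at hv
  have := congrArg ModuleCat.Hom.hom ((Abelian.Ext.mk₀_bijective _ _).1 hv)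
  have := LinearMap.congr_fun this (1 : R)
  exact ⟨f.hom (1 : R), by simpa using this⟩

end Surjective

end Local

end ExtVanishing

section ExtResidueField

variable {R : Type} [CommRing R] [IsLocalRing R]

/-- The module `Ext^d(k, Y)`. -/
abbrev ResidueExt (d : ℕ) (Y : ModuleCat.{0} R) : Type :=
  Abelian.Ext (ModuleCat.of R (ResidueField R)) Y d

/-- The map `Ext^d(k, Y) → Ext^d(k, X)` induced by `g : Y → X`. -/
def residueExtMap (d : ℕ) {Y X : ModuleCat.{0} R} (g : Y →ₗ[R] X) :
    ResidueExt d Y →ₗ[R] ResidueExt d X :=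
  Abelian.Ext.postcompOfLinear (Abelian.Ext.mk₀ (ModuleCat.ofHom g)) R _ (add_zero d)

variable {d : ℕ} {Y X Z : ModuleCat.{0} R}

lemma residueExtMap_apply (g : Y →ₗ[R] X) (u : ResidueExt d Y) :
    residueExtMap d g u = u.comp (Abelian.Ext.mk₀ (ModuleCat.ofHom g)) (add_zero d) := rfl

lemma residueExtMap_id (u : ResidueExt d Y) : residueExtMap d LinearMap.id u = u :=
  Abelian.Ext.comp_mk₀_id u

lemma residueExtMap_comp (h : X →ₗ[R] Z) (g : Y →ₗ[R] X) (u : ResidueExt d Y) :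
    residueExtMap d (h ∘ₗ g) u = residueExtMap d h (residueExtMap d g u) := by
  simp only [residueExtMap_apply, Abelian.Ext.comp_assoc_of_third_deg_zero,
    Abelian.Ext.mk₀_comp_mk₀, ModuleCat.ofHom_comp]

lemma residueExtMap_add (g h : Y →ₗ[R] X) (u : ResidueExt d Y) :
    residueExtMap d (g + h) u = residueExtMap d g u + residueExtMap d h u := by
  simp only [residueExtMap_apply, ModuleCat.ofHom_add, Abelian.Ext.mk₀_add, Abelian.Ext.comp_add]

lemma residueExtMap_zero (u : ResidueExt d Y) : residueExtMap d (0 : Y →ₗ[R] X) u = 0 := by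
  simpa using residueExtMap_add (d := d) (0 : Y →ₗ[R] X) 0 u

lemma residueExtMap_sub (g h : Y →ₗ[R] X) (u : ResidueExt d Y) :
    residueExtMap d (g - h) u = residueExtMap d g u - residueExtMap d h u := by
  rw [eq_sub_iff_add_eq, ← residueExtMap_add, sub_add_cancel]

lemma residueExtMap_sum {ι : Type*} (s : Finset ι) (g : ι → Y →ₗ[R] X) (u : ResidueExt d Y) :
    residueExtMap d (∑ i ∈ s, g i) u = ∑ i ∈ s, residueExtMap d (g i) u := by
  classical
  induction s using Finset.induction_on with
  | empty => simp [residueExtMap_zero]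
  | insert i s hi ih => rw [Finset.sum_insert hi, Finset.sum_insert hi, residueExtMap_add, ih]

section Exact

variable {A B C V : ModuleCat.{0} R} {f : A →ₗ[R] B} {g : B →ₗ[R] C}
  (hf : Function.Injective f) (hg : Function.Surjective g) (hfg : Function.Exact f g)

include hf hg hfg

omit [IsLocalRing R] in
lemma InjDimLE.middle {n : ℕ} (hA : InjDimLE n A) (hC : InjDimLE n C) : InjDimLE n B :=
  fun M _ i hi e => by
    obtain ⟨e', rfl⟩ := Abelian.Ext.covariant_sequence_exact₂ M (shortExact_of_exact f g hf hg hfg) e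
      (hC M i hi _)
    rw [hA M i hi e', Abelian.Ext.zero_comp]

omit [IsLocalRing R] in
lemma InjDimLE.cokernel {n : ℕ} (hA : InjDimLE n A) (hB : InjDimLE n B) : InjDimLE n C :=
  fun M _ i hi e => by
    obtain ⟨e', rfl⟩ := Abelian.Ext.covariant_sequence_exact₃ M (shortExact_of_exact f g hf hg hfg) e
      rfl (hA M (i + 1) (by omega) _)
    rw [hB M i hi e', Abelian.Ext.zero_comp]

omit [IsLocalRing R] in
lemma InjDimLE.kernel {n : ℕ} (hB : InjDimLE n B) (hC : InjDimLE n C) : InjDimLE (n + 1) A :=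
  fun M _ i hi e => by
    obtain ⟨i, rfl⟩ : ∃ j, i = j + 1 := ⟨i - 1, by omega⟩
    obtain ⟨e', rfl⟩ := Abelian.Ext.covariant_sequence_exact₁ M (shortExact_of_exact f g hf hg hfg) e
      (hB M (i + 1) (by omega) _) rfl
    rw [hC M i (by omega) e', Abelian.Ext.zero_comp]

lemma DepthGE.middle {n : ℕ} (hA : DepthGE n A) (hC : DepthGE n C) : DepthGE n B :=
  fun i hi e => by
    obtain ⟨e', rfl⟩ := Abelian.Ext.covariant_sequence_exact₂ _ (shortExact_of_exact f g hf hg hfg) e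
      (hC i hi _)
    rw [hA i hi e', Abelian.Ext.zero_comp]

variable [IsNoetherianRing R]

lemma exists_comp_eq_of_injDimLE [Module.Finite R A] (hA : InjDimLE d A) [Module.Finite R X]
    (hX : DepthGE d X) (h : X →ₗ[R] C) : ∃ h' : X →ₗ[R] B, g ∘ₗ h' = h := by
  obtain ⟨e, he⟩ := Abelian.Ext.covariant_sequence_exact₃ X (shortExact_of_exact f g hf hg hfg)
    (Abelian.Ext.mk₀ (ModuleCat.ofHom h)) (zero_add 1) (hA.ext_eq_zero hX (by omega) _)
  obtain ⟨h', rfl⟩ := (Abelian.Ext.mk₀_bijective _ _).2 e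
  rw [Abelian.Ext.mk₀_comp_mk₀] at he
  exact ⟨h'.hom, congrArg ModuleCat.Hom.hom ((Abelian.Ext.mk₀_bijective _ _).1 he)⟩

lemma exists_extend_of_injDimLE [Module.Finite R V] (hV : InjDimLE d V) [Module.Finite R C]
    (hC : DepthGE d C) (h : A →ₗ[R] V) : ∃ h' : B →ₗ[R] V, h' ∘ₗ f = h := by
  obtain ⟨e, he⟩ := Abelian.Ext.contravariant_sequence_exact₁ (shortExact_of_exact f g hf hg hfg) V
    (Abelian.Ext.mk₀ (ModuleCat.ofHom h)) (add_zero 1) (hV.ext_eq_zero hC (by omega) _)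
  obtain ⟨h', rfl⟩ := (Abelian.Ext.mk₀_bijective _ _).2 e
  rw [Abelian.Ext.mk₀_comp_mk₀] at he
  exact ⟨h'.hom, congrArg ModuleCat.Hom.hom ((Abelian.Ext.mk₀_bijective _ _).1 he)⟩

end Exact

omit [IsLocalRing R] in
lemma InjDimLE.prod {n : ℕ} (hY : InjDimLE n Y) (hX : InjDimLE n X) :
    InjDimLE n (ModuleCat.of R (Y × X)) :=
  InjDimLE.middle (f := LinearMap.inl R Y X) (g := LinearMap.snd R Y X) LinearMap.inl_injective
    LinearMap.snd_surjective Function.Exact.inl_snd hY hX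

lemma DepthGE.prod {n : ℕ} (hY : DepthGE n Y) (hX : DepthGE n X) :
    DepthGE n (ModuleCat.of R (Y × X)) :=
  DepthGE.middle (f := LinearMap.inl R Y X) (g := LinearMap.snd R Y X) LinearMap.inl_injective
    LinearMap.snd_surjective Function.Exact.inl_snd hY hX

omit [IsLocalRing R] in
lemma InjDimLE.pi {n : ℕ} (hY : InjDimLE n Y) (m : ℕ) :
    InjDimLE n (ModuleCat.of R (Fin m → Y)) := fun M _ i hi e => by
  have : 𝟙 (ModuleCat.of R (Fin m → Y)) = ∑ j : Fin m,
      (ModuleCat.ofHom (LinearMap.proj j) : ModuleCat.of R (Fin m → Y) ⟶ Y) ≫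
        ModuleCat.ofHom (LinearMap.single R (fun _ => (Y : Type)) j) := by
    ext y k
    simp [ModuleCat.hom_sum, Finset.sum_apply, Pi.single_apply]
  rw [← Abelian.Ext.comp_mk₀_id e, this, Abelian.Ext.mk₀_sum, Abelian.Ext.comp_sum]
  refine Finset.sum_eq_zero fun j _ => ?_
  rw [← Abelian.Ext.mk₀_comp_mk₀, ← Abelian.Ext.comp_assoc_of_third_deg_zero, hY M i hi (e.comp _ _),
    Abelian.Ext.zero_comp]

variable [IsNoetherianRing R]

lemma length_residueExt_ne_top [Module.Finite R Y] : Module.length R (ResidueExt d Y) ≠ ⊤ := by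
  obtain ⟨n, u, hu⟩ := Module.Finite.exists_fin (R := R) (M := ResidueExt d Y)
  let F : (Fin n → ResidueField R) →ₗ[R] ResidueExt d Y :=
    LinearMap.lsum R (fun _ => ResidueField R) R fun i =>
      Submodule.liftQ (maximalIdeal R) (LinearMap.toSpanSingleton R _ (u i))
        (fun r hr => smul_ext_residueField hr (u i))
  have hF : Function.Surjective F := by
    rw [← LinearMap.range_eq_top, eq_top_iff, ← hu, Submodule.span_le]
    rintro _ ⟨i, rfl⟩
    refine ⟨Pi.single i 1, ?_⟩
    exact (LinearMap.lsum_piSingle ..).trans (one_smul R (u i))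
  have := isArtinian_of_surjective _ F hF
  exact Module.length_ne_top

lemma surjective_of_residueExtMap (hd : DepthGE d (ModuleCat.of R R)) [Module.Finite R Y]
    [Module.Finite R X] (hY : InjDimLE d Y) (hX : InjDimLE d X) {t : Y →ₗ[R] X}
    (ht : Function.Surjective (residueExtMap d t)) : Function.Surjective t :=
  surjective_of_ext_residueField hY hX (ModuleCat.ofHom t) ht hd

lemma bijective_of_residueExtMap_sub_id (hd : DepthGE d (ModuleCat.of R R)) [Module.Finite R Y]
    (hY : InjDimLE d Y) {e : Y →ₗ[R] Y} (he : residueExtMap d e = 0) :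
    Function.Bijective (LinearMap.id + e : Y →ₗ[R] Y) := by
  have h : Function.Surjective (LinearMap.id + e : Y →ₗ[R] Y) :=
    surjective_of_residueExtMap hd hY hY fun u => ⟨u, by
      rw [residueExtMap_add, he, residueExtMap_id, LinearMap.zero_apply, add_zero]⟩
  exact OrzechProperty.bijective_of_surjective_endomorphism _ h

end ExtResidueField

section Minimal

variable {R : Type} [CommRing R]

/-- The splitting of `Y` induced by a section `s` of `p : Y → N`. -/
def splitEquiv {Y N : Type*} [AddCommGroup Y] [AddCommGroup N] [Module R Y] [Module R N]
    (p : Y →ₗ[R] N) (s : N →ₗ[R] Y) (h : ∀ n, p (s n) = n) : Y ≃ₗ[R] N × LinearMap.ker p where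
  toFun y := (p y, ⟨y - s (p y), by simp [h]⟩)
  invFun z := s z.1 + z.2
  map_add' a b := by ext <;> simp; abel
  map_smul' r a := by ext <;> simp [smul_sub]
  left_inv y := by simp
  right_inv z := by ext <;> simp [h]

lemma hasCommonSummandVia_of_comp_eq {Y X N : ModuleCat.{0} R} [Nontrivial N] {σ : Y →ₗ[R] X}
    (q : X →ₗ[R] N) (s : N →ₗ[R] Y) (h : ∀ n, q (σ (s n)) = n) : HasCommonSummandVia R σ := by
  refine ⟨N, ModuleCat.of R (LinearMap.ker (q ∘ₗ σ)), ModuleCat.of R (LinearMap.ker q),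
    inferInstance, splitEquiv (q ∘ₗ σ) s h, splitEquiv q (σ ∘ₗ s) h,
    σ.restrict fun y hy => hy, fun y => ?_⟩
  exact Prod.ext rfl (Subtype.ext (map_sub σ y (s (q (σ y)))).symm)

variable [IsLocalRing R] [IsNoetherianRing R] {d : ℕ}

/-- A class in `Ext^d(k, W)` which generates `Ext^d(k, Y)` under maps `W → Y`, for all `Y` of
injective dimension at most `d`. -/
def IsUniversalClass {W : ModuleCat.{0} R} (c : ResidueExt d W) : Prop :=
  ∀ (Y : ModuleCat.{0} R) [Module.Finite R Y], InjDimLE d Y → ∀ u : ResidueExt d Y,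
    ∃ s : W →ₗ[R] Y, residueExtMap d s c = u

lemma exists_isUniversalClass {W : ModuleCat.{0} R} [Module.Finite R W] (hW : DepthGE d W)
    {e : ResidueExt d W} (he : e ≠ 0) : ∃ c : ResidueExt d W, IsUniversalClass c := by
  obtain ⟨c, hc⟩ := exists_ext_comp_eq hW e he
  refine ⟨c, fun Y _ hY u => ?_⟩
  obtain ⟨h, rfl⟩ := hc d 0 (add_zero d) Y hY u
  obtain ⟨s, rfl⟩ := (Abelian.Ext.mk₀_bijective _ _).2 h
  exact ⟨s.hom, rfl⟩

variable (hd : DepthGE d (ModuleCat.of R R)) {e₀ : ResidueExt d (ModuleCat.of R R)} (he₀ : e₀ ≠ 0)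
  {W : ModuleCat.{0} R} [Module.Finite R W] (hW : InjDimLE d W) {c : ResidueExt d W}
  (hc : IsUniversalClass c)

include hd he₀ hW hc in
lemma exists_eq_sum_comp {Y X : ModuleCat.{0} R} [Module.Finite R Y] [Module.Finite R X]
    (hY : InjDimLE d Y) (hX : DepthGE d X) (g : X →ₗ[R] Y) :
    ∃ (m : ℕ) (s : Fin m → W →ₗ[R] Y) (q : Fin m → X →ₗ[R] W), g = ∑ i, s i ∘ₗ q i := by
  obtain ⟨m, u, hu⟩ := Module.Finite.exists_fin (R := R) (M := ResidueExt d Y)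
  choose s hs using fun i => hc Y hY (u i)
  let V := ModuleCat.of R (Fin m → W)
  let t : V →ₗ[R] Y := ∑ i, s i ∘ₗ LinearMap.proj i
  have ht (i : Fin m) : t ∘ₗ LinearMap.single R (fun _ => (W : Type)) i = s i := by
    ext w
    simp only [t, LinearMap.comp_apply, LinearMap.sum_apply]
    change ∑ x, s x (Pi.single (M := fun _ => (W : Type)) i w x) = s i w
    simp [Pi.single_apply, apply_ite]
  have htsurj : Function.Surjective (residueExtMap (Y := V) d t) := fun v => by
    have hv : v ∈ Submodule.span R (Set.range u) := hu ▸ Submodule.mem_top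
    obtain ⟨r, rfl⟩ := (Submodule.mem_span_range_iff_exists_fun R).1 hv
    refine ⟨∑ i, r i • residueExtMap (X := V) d (LinearMap.single R (fun _ => (W : Type)) i) c, ?_⟩
    simp only [map_sum, map_smul, ← residueExtMap_comp, ht, hs]
  have hsurj := surjective_of_residueExtMap (Y := V) hd (hW.pi m) hY htsurj
  have hK : InjDimLE d (ModuleCat.of R (LinearMap.ker t)) :=
    (InjDimLE.kernel (B := V) (LinearMap.ker t).injective_subtype hsurj
      (LinearMap.exact_subtype_ker_map t) (hW.pi m) hY).le_depth hd he₀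
  obtain ⟨h, rfl⟩ := exists_comp_eq_of_injDimLE (A := ModuleCat.of R (LinearMap.ker t)) (B := V)
    (LinearMap.ker t).injective_subtype hsurj (LinearMap.exact_subtype_ker_map t) hK hX g
  refine ⟨m, s, fun i => LinearMap.proj i ∘ₗ h, ?_⟩
  ext x
  simp [t]

include hd he₀ hW hc in
lemma residueExtMap_comp_eq_zero [Nontrivial W] [IsSimpleModule R (ResidueExt d W)]
    {Y X : ModuleCat.{0} R} [Module.Finite R Y] [Module.Finite R X]
    (hY : InjDimLE d Y) (hX : DepthGE d X) {σ : Y →ₗ[R] X} (hσ : ¬ HasCommonSummandVia R σ)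
    (g : X →ₗ[R] Y) : residueExtMap d (g ∘ₗ σ) = 0 := by
  obtain ⟨m, t, q, rfl⟩ := exists_eq_sum_comp hd he₀ hW hc hY hX g
  have key (i : Fin m) (s : W →ₗ[R] Y) : residueExtMap d (q i ∘ₗ σ ∘ₗ s) = 0 := by
    by_contra hne
    have hf := OrzechProperty.bijective_of_surjective_endomorphism _
      (surjective_of_residueExtMap hd hW hW (LinearMap.bijective_of_ne_zero hne).2)
    let F := LinearEquiv.ofBijective _ hf
    exact hσ (hasCommonSummandVia_of_comp_eq (F.symm.toLinearMap ∘ₗ q i) s fun n =>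
      F.symm_apply_apply n)
  ext u
  obtain ⟨s, rfl⟩ := hc Y hY u
  have : ((∑ i, t i ∘ₗ q i) ∘ₗ σ) ∘ₗ s = ∑ i, t i ∘ₗ (q i ∘ₗ σ ∘ₗ s) := by
    ext w
    simp
  rw [← residueExtMap_comp, this, residueExtMap_sum, LinearMap.zero_apply]
  exact Finset.sum_eq_zero fun i _ => by rw [residueExtMap_comp, key, LinearMap.zero_apply, map_zero]

section Comparison

variable {Y X Y' X' : ModuleCat.{0} R} [Module.Finite R Y] (hY : InjDimLE d Y) {σ : Y →ₗ[R] X}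
  (hσ : ∀ g : X →ₗ[R] Y, residueExtMap d (g ∘ₗ σ) = 0)

include hd hY hσ

lemma exists_add_comp_eq (g : X →ₗ[R] Y) : ∃ v : X →ₗ[R] Y, v + g ∘ₗ σ ∘ₗ v = g := by
  let U := LinearEquiv.ofBijective _ (bijective_of_residueExtMap_sub_id hd hY (hσ g))
  refine ⟨U.symm.toLinearMap ∘ₗ g, ?_⟩
  ext x
  exact U.apply_symm_apply (g x)

/-- A map from the base of a minimal sequence to that of another one is split, and bijective as
soon as it is surjective on `Ext^d(k, -)`. -/
lemma exists_inverse_of_comparison [Module.Finite R Y'] (hY' : InjDimLE d Y') {σ' : Y' →ₗ[R] X'}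
    {α : Y →ₗ[R] Y'} {a : X →ₗ[R] X'} {b : X' →ₗ[R] X} {g : X →ₗ[R] Y} {g' : X' →ₗ[R] Y'}
    (hα : ∀ y, σ' (α y) = a (σ y)) (hba : ∀ x, b (a x) = x + σ (g x))
    (hab : ∀ x, a (b x) = x + σ' (g' x)) :
    ∃ b' : X' →ₗ[R] X, (∀ x, b' (a x) = x) ∧
      (Function.Surjective (residueExtMap d a) → Function.Bijective a) := by
  obtain ⟨v, hv⟩ := exists_add_comp_eq hd hY hσ g
  replace hv (x : X) : v x + g (σ (v x)) = g x := LinearMap.congr_fun hv x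
  have hinj : Function.Injective (b ∘ₗ a) := by
    rw [← LinearMap.ker_eq_bot, LinearMap.ker_eq_bot']
    intro x hx
    replace hx : x + σ (g x) = 0 := (hba x).symm.trans hx
    have hgx : g x = 0 := by
      refine (bijective_of_residueExtMap_sub_id hd hY (hσ g)).1 ?_
      simpa using congrArg g hx
    simpa [hgx] using hx
  let w : X →ₗ[R] X := LinearMap.id - σ ∘ₗ v
  have hw (x : X) : b (a (w x)) = x := by
    rw [hba]
    simp only [w, LinearMap.sub_apply, LinearMap.id_apply, LinearMap.comp_apply, map_sub, ← hv x]
    simp only [map_add]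
    abel
  have hw' (x : X) : w (b (a x)) = x := hinj (hw _)
  refine ⟨w ∘ₗ b, hw', fun hsurj => ?_⟩
  let G : X' →ₗ[R] Y' := α ∘ₗ v ∘ₗ b - g'
  have hG (x : X') : σ' (G x) = x - a (w (b x)) := by
    simp only [G, w, LinearMap.sub_apply, LinearMap.id_apply, LinearMap.comp_apply, map_sub, hα, hab]
    abel
  have hEa : residueExtMap d (σ' ∘ₗ G) = 0 := by
    ext u
    obtain ⟨u, rfl⟩ := hsurj u
    have : (σ' ∘ₗ G) ∘ₗ a = 0 := by
      ext x
      simp [hG, hw']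
    rw [← residueExtMap_comp, this, residueExtMap_zero, LinearMap.zero_apply]
  have hidem (x : X') : σ' (G (σ' (G x))) = σ' (G x) := by
    rw [hG (σ' (G x)), sub_eq_self, hG x]
    simp only [map_sub, hw, sub_self, map_zero]
  let e : Y' →ₗ[R] Y' := G ∘ₗ σ'
  have he : residueExtMap d (-(e ∘ₗ e)) = 0 := by
    ext u
    have : -(e ∘ₗ e) = 0 - G ∘ₗ (σ' ∘ₗ G) ∘ₗ σ' := by
      rw [zero_sub]
      rfl
    rw [this, residueExtMap_sub, residueExtMap_comp, residueExtMap_comp, hEa, residueExtMap_zero]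
    simp
  have hee (y : Y') : e (e y) = 0 := by
    obtain ⟨y, rfl⟩ := (bijective_of_residueExtMap_sub_id hd hY' he).2 y
    have : e (e (e (e y))) = e (e y) := by
      simp only [e, LinearMap.comp_apply, hidem]
    simp [this]
  have hzero (x : X') : σ' (G x) = 0 := by
    have := hee (G x)
    simp only [e, LinearMap.comp_apply, hidem] at this
    rw [← hidem x, this, map_zero]
  refine ⟨fun x y hxy => hinj (congrArg b hxy), fun x => ⟨w (b x), ?_⟩⟩
  exact (sub_eq_zero.1 ((hG x).symm.trans (hzero x))).symm

/-- Numerical form of the comparison of a minimal sequence with another one. -/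
lemma length_residueExt_le_of_comparison [Module.Finite R X'] [Module.Finite R Y']
    (hY' : InjDimLE d Y') {σ' : Y' →ₗ[R] X'}
    {α : Y →ₗ[R] Y'} {a : X →ₗ[R] X'} {b : X' →ₗ[R] X} {g : X →ₗ[R] Y} {g' : X' →ₗ[R] Y'}
    (hα : ∀ y, σ' (α y) = a (σ y)) (hba : ∀ x, b (a x) = x + σ (g x))
    (hab : ∀ x, a (b x) = x + σ' (g' x)) :
    Module.length R (ResidueExt d X) ≤ Module.length R (ResidueExt d X') ∧
      (Module.length R (ResidueExt d X) = Module.length R (ResidueExt d X') →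
        Nonempty (X ≃ₗ[R] X')) := by
  obtain ⟨b', hb', hbij⟩ := exists_inverse_of_comparison hd hY hσ hY' hα hba hab
  have hinj : Function.Injective (residueExtMap d a) :=
    Function.LeftInverse.injective (g := residueExtMap d b') fun u => by
      rw [← residueExtMap_comp, show b' ∘ₗ a = LinearMap.id from LinearMap.ext hb',
        residueExtMap_id]
  refine ⟨Module.length_le_of_injective _ hinj, fun h => ⟨LinearEquiv.ofBijective a (hbij ?_)⟩⟩
  by_contra hsurj
  have := length_residueExt_ne_top (d := d) (Y := X')
  rw [Module.length_ne_top_iff, isFiniteLength_iff_isNoetherian_isArtinian] at this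
  obtain ⟨_, _⟩ := this
  have hlt := Submodule.length_lt (mt LinearMap.range_eq_top.1 hsurj)
  rw [← (LinearEquiv.ofInjective _ hinj).length_eq, h] at hlt
  exact hlt.false

end Comparison

end Minimal

section SequenceComparison

variable {R : Type} [CommRing R]

lemma exists_comp_eq_of_surjective {A B C : Type*} [AddCommGroup A] [AddCommGroup B]
    [AddCommGroup C] [Module R A] [Module R B] [Module R C] {p : A →ₗ[R] B}
    (hp : Function.Surjective p) (h : A →ₗ[R] C) (hh : ∀ y, p y = 0 → h y = 0) :
    ∃ a : B →ₗ[R] C, ∀ y, a (p y) = h y := by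
  refine ⟨(LinearMap.ker p).liftQ h hh ∘ₗ (p.quotKerEquivOfSurjective hp).symm.toLinearMap,
    fun y => ?_⟩
  have : (p.quotKerEquivOfSurjective hp).symm (p y) = (LinearMap.ker p).mkQ y :=
    (LinearEquiv.symm_apply_eq _).2 rfl
  exact (congrArg _ this).trans rfl

lemma exists_comp_eq_of_injective {A B C : Type*} [AddCommGroup A] [AddCommGroup B]
    [AddCommGroup C] [Module R A] [Module R B] [Module R C] {s : B →ₗ[R] A}
    (hs : Function.Injective s) (h : C →ₗ[R] A) (hh : ∀ x, ∃ b, s b = h x) :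
    ∃ g : C →ₗ[R] B, ∀ x, s (g x) = h x := by
  refine ⟨(LinearEquiv.ofInjective s hs).symm.toLinearMap ∘ₗ h.codRestrict _ hh, fun x => ?_⟩
  exact congrArg Subtype.val ((LinearEquiv.ofInjective s hs).apply_symm_apply _)

variable [IsLocalRing R] [IsNoetherianRing R] {d : ℕ} (hd : DepthGE d (ModuleCat.of R R))

section

variable {M N Y X Y' X' : ModuleCat.{0} R}
  [Module.Finite R Y] [Module.Finite R X] [Module.Finite R Y'] [Module.Finite R X']
  (hY : InjDimLE d Y) (hX : DepthGE d X) (hY' : InjDimLE d Y') (hX' : DepthGE d X')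

include hd hY hX hY' hX'

lemma length_residueExt_le_of_hull {i : M →ₗ[R] Y} {p : Y →ₗ[R] X} {i' : M →ₗ[R] Y'}
    {p' : Y' →ₗ[R] X'} (hi : Function.Injective i) (hp : Function.Surjective p)
    (hip : Function.Exact i p) (hi' : Function.Injective i') (hp' : Function.Surjective p')
    (hip' : Function.Exact i' p') (hmin : ∀ g : X →ₗ[R] Y, residueExtMap d (g ∘ₗ p) = 0) :
    Module.length R (ResidueExt d X) ≤ Module.length R (ResidueExt d X') ∧
      (Module.length R (ResidueExt d X) = Module.length R (ResidueExt d X') →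
        Nonempty (X ≃ₗ[R] X')) := by
  obtain ⟨α, hα⟩ := exists_extend_of_injDimLE hi hp hip hY' hX i'
  obtain ⟨β, hβ⟩ := exists_extend_of_injDimLE hi' hp' hip' hY hX' i
  replace hα (m : M) : α (i m) = i' m := LinearMap.congr_fun hα m
  replace hβ (m : M) : β (i' m) = i m := LinearMap.congr_fun hβ m
  obtain ⟨a, ha⟩ := exists_comp_eq_of_surjective hp (p' ∘ₗ α) fun y hy => by
    obtain ⟨m, rfl⟩ := (hip y).1 hy
    simp [hα, hip'.apply_apply_eq_zero]
  obtain ⟨b, hb⟩ := exists_comp_eq_of_surjective hp' (p ∘ₗ β) fun y hy => by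
    obtain ⟨m, rfl⟩ := (hip' y).1 hy
    simp [hβ, hip.apply_apply_eq_zero]
  obtain ⟨g, hg⟩ := exists_comp_eq_of_surjective hp (β ∘ₗ α - LinearMap.id) fun y hy => by
    obtain ⟨m, rfl⟩ := (hip y).1 hy
    simp [hα, hβ]
  obtain ⟨g', hg'⟩ := exists_comp_eq_of_surjective hp' (α ∘ₗ β - LinearMap.id) fun y hy => by
    obtain ⟨m, rfl⟩ := (hip' y).1 hy
    simp [hα, hβ]
  refine length_residueExt_le_of_comparison hd hY hmin hY' (fun y => (ha y).symm)
    (g := g) (g' := g') (b := b) (hp.forall.2 fun y => ?_) (hp'.forall.2 fun y => ?_)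
  · simp [ha, hb, hg]
  · simp [ha, hb, hg']

lemma length_residueExt_le_of_approx {i : Y →ₗ[R] X} {p : X →ₗ[R] N} {i' : Y' →ₗ[R] X'}
    {p' : X' →ₗ[R] N} (hi : Function.Injective i) (hp : Function.Surjective p)
    (hip : Function.Exact i p) (hi' : Function.Injective i') (hp' : Function.Surjective p')
    (hip' : Function.Exact i' p') (hmin : ∀ g : X →ₗ[R] Y, residueExtMap d (g ∘ₗ i) = 0) :
    Module.length R (ResidueExt d X) ≤ Module.length R (ResidueExt d X') ∧
      (Module.length R (ResidueExt d X) = Module.length R (ResidueExt d X') →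
        Nonempty (X ≃ₗ[R] X')) := by
  obtain ⟨a, ha⟩ := exists_comp_eq_of_injDimLE hi' hp' hip' hY' hX p
  obtain ⟨b, hb⟩ := exists_comp_eq_of_injDimLE hi hp hip hY hX' p'
  replace ha (x : X) : p' (a x) = p x := LinearMap.congr_fun ha x
  replace hb (x : X') : p (b x) = p' x := LinearMap.congr_fun hb x
  obtain ⟨α, hα⟩ := exists_comp_eq_of_injective hi' (a ∘ₗ i) fun y => (hip' _).1 <| by
    simp [ha, hip.apply_apply_eq_zero]
  obtain ⟨g, hg⟩ := exists_comp_eq_of_injective hi (b ∘ₗ a - LinearMap.id) fun y =>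
    (hip _).1 <| by simp [ha, hb]
  obtain ⟨g', hg'⟩ := exists_comp_eq_of_injective hi' (a ∘ₗ b - LinearMap.id) fun y =>
    (hip' _).1 <| by simp [ha, hb]
  refine length_residueExt_le_of_comparison hd hY hmin hY' (α := α) (a := a) (b := b) (g := g)
    (g' := g') hα (fun x => ?_) (fun x => ?_)
  · simp [hg]
  · simp [hg']

end

omit [IsNoetherianRing R] in
lemma length_residueExt_prod_le {Y X : ModuleCat.{0} R} :
    Module.length R (ResidueExt d (ModuleCat.of R (Y × X))) ≤
      Module.length R (ResidueExt d Y) + Module.length R (ResidueExt d X) := by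
  let Z := ModuleCat.of R (Y × X)
  rw [← Module.length_prod]
  refine Module.length_le_of_injective ((residueExtMap (Y := Z) d (LinearMap.fst R Y X)).prod
    (residueExtMap (Y := Z) d (LinearMap.snd R Y X))) ?_
  rw [← LinearMap.ker_eq_bot, LinearMap.ker_eq_bot']
  intro u hu
  obtain ⟨h₁, h₂⟩ := Prod.ext_iff.1 hu
  have : (LinearMap.id : Z →ₗ[R] Z) = LinearMap.inl R Y X ∘ₗ LinearMap.fst R Y X +
      LinearMap.inr R Y X ∘ₗ LinearMap.snd R Y X :=
    LinearMap.ext fun z => Prod.ext (add_zero z.1).symm (zero_add z.2).symm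
  rw [← residueExtMap_id u, this, residueExtMap_add, residueExtMap_comp (X := Y),
    residueExtMap_comp (X := X)]
  change residueExtMap (Y := Z) d (LinearMap.fst R Y X) u = 0 at h₁
  change residueExtMap (Y := Z) d (LinearMap.snd R Y X) u = 0 at h₂
  rw [h₁, h₂, map_zero, map_zero, add_zero]

section Bridge

variable {W C M N Y₁ X₁ Y₂ X₂ : ModuleCat.{0} R}
  [Module.Finite R X₁] [Module.Finite R Y₂] [Module.Finite R X₂] [Module.Finite R C]
  (hY₁ : InjDimLE d Y₁) (hX₁ : DepthGE d X₁) (hY₂ : InjDimLE d Y₂) (hX₂ : DepthGE d X₂)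
  (hC : InjDimLE d C)
  {j : M →ₗ[R] C} {q : C →ₗ[R] N} (hj : Function.Injective j) (hq : Function.Surjective q)
  (hjq : Function.Exact j q)
  {ι₁ : Y₁ →ₗ[R] X₁} {π₁ : X₁ →ₗ[R] N} (hι₁ : Function.Injective ι₁)
  (hπ₁ : Function.Surjective π₁) (h₁ : Function.Exact ι₁ π₁)
  {ι₂ : M →ₗ[R] Y₂} {π₂ : Y₂ →ₗ[R] X₂} (hι₂ : Function.Injective ι₂)
  (hπ₂ : Function.Surjective π₂) (h₂ : Function.Exact ι₂ π₂)

include hd hY₁ hX₁ hY₂ hX₂ hC hj hq hjq hι₁ hπ₁ h₁ hι₂ hπ₂ h₂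

lemma length_residueExt_hull_le_approx
    (hmin : ∀ g : X₂ →ₗ[R] Y₂, residueExtMap d (g ∘ₗ π₂) = 0) :
    Module.length R (ResidueExt d X₂) ≤ Module.length R (ResidueExt d X₁) ∧
      (Module.length R (ResidueExt d X₂) = Module.length R (ResidueExt d X₁) →
        Nonempty (X₂ ≃ₗ[R] X₁)) := by
  let D : (X₁ × C) →ₗ[R] N := π₁ ∘ₗ LinearMap.fst R X₁ C - q ∘ₗ LinearMap.snd R X₁ C
  have hD (z : X₁ × C) : z ∈ LinearMap.ker D ↔ π₁ z.1 = q z.2 := by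
    rw [LinearMap.mem_ker]
    exact sub_eq_zero
  let P := ModuleCat.of R (LinearMap.ker D)
  have hP : InjDimLE d P := by
    let f : Y₁ →ₗ[R] P := (LinearMap.inl R X₁ C ∘ₗ ι₁).codRestrict _ fun y =>
      (hD _).2 (by simp [h₁.apply_apply_eq_zero])
    refine InjDimLE.middle (f := f) (g := LinearMap.snd R X₁ C ∘ₗ (LinearMap.ker D).subtype)
      ?_ ?_ ?_ hY₁ hC
    · intro y y' h
      exact hι₁ (congrArg (fun z : P => z.1.1) h)
    · intro c
      obtain ⟨z, hz⟩ := hπ₁ (q c)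
      exact ⟨⟨(z, c), (hD _).2 hz⟩, rfl⟩
    · rintro ⟨⟨z, c⟩, hz⟩
      refine ⟨fun h => ?_, ?_⟩
      · obtain rfl : c = 0 := h
        obtain ⟨y, rfl⟩ := (h₁ z).1 (((hD _).1 hz).trans (map_zero q))
        exact ⟨y, rfl⟩
      · rintro ⟨y, hy⟩
        exact congrArg (fun z : P => z.1.2) hy.symm
  let f : M →ₗ[R] P := (LinearMap.inr R X₁ C ∘ₗ j).codRestrict _ fun y =>
    (hD _).2 (by simp [hjq.apply_apply_eq_zero])
  refine length_residueExt_le_of_hull (Y' := P) (i' := f)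
    (p' := LinearMap.fst R X₁ C ∘ₗ (LinearMap.ker D).subtype) hd hY₂ hX₂ hP hX₁ hι₂ hπ₂ h₂
    ?_ ?_ ?_ hmin
  · intro y y' h
    exact hj (congrArg (fun z : P => z.1.2) h)
  · intro z
    obtain ⟨c, hc⟩ := hq (π₁ z)
    exact ⟨⟨(z, c), (hD _).2 hc.symm⟩, rfl⟩
  · rintro ⟨⟨z, c⟩, hz⟩
    refine ⟨fun h => ?_, ?_⟩
    · obtain rfl : z = 0 := h
      obtain ⟨y, rfl⟩ := (hjq c).1 (((hD _).1 hz).symm.trans (map_zero π₁))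
      exact ⟨y, rfl⟩
    · rintro ⟨y, hy⟩
      exact congrArg (fun z : P => z.1.1) hy.symm

lemma length_residueExt_approx_le_hull_prod [Module.Finite R W] [Module.Finite R Y₁]
    (hW : InjDimLE d W) (hWX : DepthGE d W)
    {κ : W →ₗ[R] W} {p : W →ₗ[R] C} (hκ : Function.Injective κ) (hp : Function.Surjective p)
    (hκp : Function.Exact κ p)
    (hmin : ∀ g : X₁ →ₗ[R] Y₁, residueExtMap d (g ∘ₗ ι₁) = 0) :
    Module.length R (ResidueExt d X₁) ≤
        Module.length R (ResidueExt d (ModuleCat.of R (W × X₂))) ∧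
      (Module.length R (ResidueExt d X₁) =
          Module.length R (ResidueExt d (ModuleCat.of R (W × X₂))) →
        Nonempty (X₁ ≃ₗ[R] (W × X₂))) := by
  obtain ⟨γ, hγ⟩ := exists_extend_of_injDimLE hι₂ hπ₂ h₂ hC hX₂ j
  replace hγ (m : M) : γ (ι₂ m) = j m := LinearMap.congr_fun hγ m
  obtain ⟨n, hn⟩ := exists_comp_eq_of_surjective hπ₂ (q ∘ₗ γ) fun y hy => by
    obtain ⟨m, rfl⟩ := (h₂ y).1 hy
    simp [hγ, hjq.apply_apply_eq_zero]
  let D : (W × Y₂) →ₗ[R] C := p ∘ₗ LinearMap.fst R W Y₂ - γ ∘ₗ LinearMap.snd R W Y₂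
  have hD (z : W × Y₂) : z ∈ LinearMap.ker D ↔ p z.1 = γ z.2 := by
    rw [LinearMap.mem_ker]
    exact sub_eq_zero
  let P := ModuleCat.of R (LinearMap.ker D)
  let Z := ModuleCat.of R (W × X₂)
  have hP : InjDimLE d P := by
    let f : W →ₗ[R] P := (LinearMap.inl R W Y₂ ∘ₗ κ).codRestrict _ fun y =>
      (hD _).2 (by simp [hκp.apply_apply_eq_zero])
    refine InjDimLE.middle (f := f) (g := LinearMap.snd R W Y₂ ∘ₗ (LinearMap.ker D).subtype)
      ?_ ?_ ?_ hW hY₂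
    · intro y y' h
      exact hκ (congrArg (fun z : P => z.1.1) h)
    · intro y
      obtain ⟨w, hw⟩ := hp (γ y)
      exact ⟨⟨(w, y), (hD _).2 hw⟩, rfl⟩
    · rintro ⟨⟨w, y⟩, hz⟩
      refine ⟨fun h => ?_, ?_⟩
      · obtain rfl : y = 0 := h
        obtain ⟨y, rfl⟩ := (hκp w).1 (((hD _).1 hz).trans (map_zero γ))
        exact ⟨y, rfl⟩
      · rintro ⟨y, hy⟩
        exact congrArg (fun z : P => z.1.2) hy.symm
  refine length_residueExt_le_of_approx (X' := Z) (Y' := P)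
    (i' := (LinearMap.id.prodMap π₂ : (W × Y₂) →ₗ[R] (W × X₂)) ∘ₗ (LinearMap.ker D).subtype)
    (p' := q ∘ₗ p ∘ₗ LinearMap.fst R W X₂ - n ∘ₗ LinearMap.snd R W X₂)
    hd hY₁ hX₁ hP (hWX.prod hX₂) hι₁ hπ₁ h₁ ?_ ?_ ?_ hmin
  · rw [← LinearMap.ker_eq_bot, LinearMap.ker_eq_bot']
    rintro ⟨⟨w, y⟩, hz⟩ h
    obtain ⟨hw, hy⟩ := Prod.ext_iff.1 h
    obtain rfl : w = 0 := hw
    obtain ⟨m, rfl⟩ := (h₂ y).1 hy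
    have := (hD _).1 hz
    rw [map_zero] at this
    obtain rfl : m = 0 := hj (by rw [map_zero, ← hγ]; exact this.symm)
    exact Subtype.ext (Prod.ext rfl (map_zero ι₂))
  · intro z
    obtain ⟨c, rfl⟩ := hq z
    obtain ⟨w, rfl⟩ := hp c
    exact ⟨(w, 0), by change q (p w) - n 0 = _; rw [map_zero, sub_zero]⟩
  · rintro ⟨w, z⟩
    refine ⟨fun h => ?_, ?_⟩
    · obtain ⟨y, rfl⟩ := hπ₂ z
      replace h : q (p w) - n (π₂ y) = 0 := h
      rw [hn, LinearMap.comp_apply, ← map_sub] at h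
      obtain ⟨m, hm⟩ := (hjq _).1 h
      refine ⟨⟨(w, y + ι₂ m), (hD _).2 ?_⟩, Prod.ext rfl ?_⟩
      · simp [hγ, hm]
      · change π₂ (y + ι₂ m) = π₂ y
        simp [h₂.apply_apply_eq_zero]
    · rintro ⟨⟨⟨w, y⟩, hz⟩, h⟩
      obtain ⟨rfl, rfl⟩ := Prod.ext_iff.1 h
      have := (hD _).1 hz
      change q (p w) - n (π₂ y) = 0
      rw [hn, LinearMap.comp_apply, this, sub_self]

end Bridge

end SequenceComparison

section CanonicalIdeal

variable {R : Type} [CommRing R]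

lemma HasFiniteInjDim.exists_injDimLE {Y : ModuleCat.{0} R} (hY : HasFiniteInjDim R Y) :
    ∃ n, InjDimLE n Y := by
  obtain ⟨n, hn⟩ := hY
  refine ⟨n, fun M _ i hi e => ?_⟩
  obtain ⟨E⟩ := nonempty_modExt_equiv i M Y
  have := hn M i hi
  exact E.symm.injective (Subsingleton.elim _ _)

lemma coe_mem_span_singleton_mul_iff (ω : Ideal R) (x : R) (y : ω) :
    (y : R) ∈ Ideal.span {x} * ω ↔ ∃ z : ω, x • z = y := by
  simp only [Ideal.mem_span_singleton_mul, Subtype.exists, Subtype.ext_iff]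
  exact ⟨fun ⟨z, hz, h⟩ => ⟨z, hz, h⟩, fun ⟨z, hz, h⟩ => ⟨z, hz, h⟩⟩

/-- Ideals `K ≤ J ≤ I` give an exact sequence `0 → J / K → I / K → I / J → 0`. -/
lemma exists_exact_qmod {I J K : Ideal R} (hKJ : K ≤ J) (hJI : J ≤ I) :
    ∃ (j : qmod R J K →ₗ[R] qmod R I K) (q : qmod R I K →ₗ[R] qmod R I J),
      Function.Injective j ∧ Function.Surjective q ∧ Function.Exact j q := by
  refine ⟨Submodule.mapQ _ _ (Submodule.inclusion hJI) fun y hy => hy,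
    Submodule.factor fun y hy => hKJ hy, ?_, Submodule.factor_surjective _, ?_⟩
  · rw [← LinearMap.ker_eq_bot, LinearMap.ker_eq_bot']
    rintro ⟨y⟩ hy
    exact (Submodule.Quotient.mk_eq_zero _).2 ((Submodule.Quotient.mk_eq_zero _).1 hy :)
  · rintro ⟨y⟩
    refine ⟨fun hy => ?_, ?_⟩
    · exact ⟨Submodule.Quotient.mk ⟨y, ((Submodule.Quotient.mk_eq_zero _).1 hy :)⟩, rfl⟩
    · rintro ⟨⟨z⟩, hz⟩
      rw [← hz]
      exact (Submodule.Quotient.mk_eq_zero _).2 z.2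

variable [IsLocalRing R]

lemma depthGE_of_moduleDepth_eq {d : ℕ} {N : ModuleCat.{0} R} (h : moduleDepth R N = d) :
    DepthGE d N := by
  intro l hl e
  by_contra he
  obtain ⟨E⟩ := nonempty_modExt_equiv l (ModuleCat.of R (ResidueField R)) N
  have : moduleDepth R N ≤ l :=
    sInf_le ⟨l, rfl, ⟨E.symm e, 0, fun h' => he (E.symm.injective (h'.trans (map_zero _).symm))⟩⟩
  rw [h] at this
  exact absurd (Nat.cast_le.1 this) (by omega)

lemma exists_residueExt_ne_zero {d : ℕ} {N : ModuleCat.{0} R} (h : moduleDepth R N = d) :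
    ∃ e : ResidueExt d N, e ≠ 0 := by
  obtain hS | hS := Set.eq_empty_or_nonempty {n : ℕ∞ | ∃ m : ℕ, n = (m : ℕ∞) ∧
    Nontrivial (ModExt R m (ModuleCat.of R (ResidueField R)) N)}
  · rw [moduleDepth, hS, sInf_empty] at h
    exact absurd h (ENat.natCast_ne_top d).symm
  · obtain ⟨m, hm, hnt⟩ := csInf_mem hS
    obtain rfl : d = m := Nat.cast_injective (R := ℕ∞) (h.symm.trans hm)
    obtain ⟨E⟩ := nonempty_modExt_equiv d (ModuleCat.of R (ResidueField R)) N
    have := E.symm.toEquiv.nontrivial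
    exact exists_ne 0

lemma depthGE_of_subsingleton (d : ℕ) {N : ModuleCat.{0} R} [Subsingleton N] : DepthGE d N := fun _ _ e => by
  have : 𝟙 N = 0 := ModuleCat.hom_ext (LinearMap.ext fun _ => Subsingleton.elim _ _)
  rw [← Abelian.Ext.comp_mk₀_id e, this, Abelian.Ext.mk₀_zero, Abelian.Ext.comp_zero]

end CanonicalIdeal

end

theorem stmt6 (R : Type) [CommRing R] [IsLocalRing R]
    (hCM : IsCMLocalRing R) (hGG : IsGenericallyGorenstein R)
    (ω : Ideal R) (hω : IsCanonicalIdeal R ω)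
    (x : R) (hxω : x ∈ ω) (hxreg : x ∈ nonZeroDivisors R)
    (Y₁ X₁ : ModuleCat R) (ι₁ : Y₁ →ₗ[R] X₁) (π₁ : X₁ →ₗ[R] qmod R ω (ω ^ 2))
    (h₁ : IsMinMCMApprox R (qmod R ω (ω ^ 2)) Y₁ X₁ ι₁ π₁)
    (Y₂ X₂ : ModuleCat R) (ι₂ : (qmod R (ω ^ 2) (Ideal.span {x} * ω)) →ₗ[R] Y₂) (π₂ : Y₂ →ₗ[R] X₂)
    (h₂ : IsMinFIDHull R (qmod R (ω ^ 2) (Ideal.span {x} * ω)) Y₂ X₂ ι₂ π₂) :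
    ((Nonempty (X₁ ≃ₗ[R] X₂)) ∨ (Nonempty (X₁ ≃ₗ[R] (↥ω × X₂)))) ∧ ¬ ((Nonempty (X₁ ≃ₗ[R] X₂)) ∧ (Nonempty (X₁ ≃ₗ[R] (↥ω × X₂)))) := by
  have := hCM.1
  obtain ⟨_, hωfid, d, hd, ⟨E⟩, hE⟩ := hω
  let W := ModuleCat.of R ω
  have hdepth : moduleDepth R (ModuleCat.of R R) = d := by
    have := hCM.2
    rw [hd] at this
    exact_mod_cast this
  have hR := depthGE_of_moduleDepth_eq hdepth
  obtain ⟨e₀, he₀⟩ := exists_residueExt_ne_zero hdepth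
  have hfid {Y : ModuleCat.{0} R} [Module.Finite R Y] (hY : HasFiniteInjDim R Y) : InjDimLE d Y :=
    let ⟨_, h⟩ := hY.exists_injDimLE
    h.le_depth hR he₀
  obtain ⟨F⟩ := nonempty_modExt_equiv d (ModuleCat.of R (IsLocalRing.ResidueField R)) W
  have : IsSimpleModule R (ResidueExt d W) := IsSimpleModule.congr (F.symm ≪≫ₗ E)
  have := IsSimpleModule.nontrivial R (ResidueExt d W)
  have hW : InjDimLE d W := hfid hωfid
  have hWd : DepthGE d W := fun l hl e => by
    obtain ⟨G⟩ := nonempty_modExt_equiv l (ModuleCat.of R (IsLocalRing.ResidueField R)) W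
    have := hE l hl.ne
    exact G.symm.injective (Subsingleton.elim _ _)
  obtain ⟨e, he⟩ := exists_ne (0 : ResidueExt d W)
  obtain ⟨c, hc⟩ := exists_isUniversalClass hWd he
  have : Nontrivial W := ⟨⟨x, hxω⟩, 0, fun h =>
    nonZeroDivisors.ne_zero hxreg (congrArg Subtype.val h)⟩
  obtain ⟨⟨_, _, ⟨_, hX₁⟩, hY₁, hι₁, hπ₁, hιπ₁⟩, hmin₁⟩ := h₁
  obtain ⟨⟨_, _, hY₂, hX₂, hι₂, hπ₂, hιπ₂⟩, hmin₂⟩ := h₂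
  have := Module.Finite.of_surjective π₂ hπ₂
  replace hX₁ : DepthGE d X₁ :=
    depthGE_of_moduleDepth_eq (by rw [hd] at hX₁; exact_mod_cast hX₁)
  replace hX₂ : DepthGE d X₂ := by
    obtain ⟨_, h⟩ | _ := hX₂
    · exact depthGE_of_moduleDepth_eq (by rw [hd] at h; exact_mod_cast h)
    · exact depthGE_of_subsingleton d
  replace hY₁ := hfid hY₁
  replace hY₂ := hfid hY₂
  obtain ⟨j, q, hj, hq, hjq⟩ := exists_exact_qmod (I := ω) (J := ω ^ 2) (K := Ideal.span {x} * ω)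
    (by rw [pow_two]; exact Ideal.mul_mono_left ((Ideal.span_singleton_le_iff_mem _).2 hxω))
    (Ideal.pow_le_self two_ne_zero)
  let κ : W →ₗ[R] W := LinearMap.lsmul R ω x
  let p : W →ₗ[R] qmod R ω (Ideal.span {x} * ω) := Submodule.mkQ _
  have hκ : Function.Injective κ := fun a b h => Subtype.ext <|
    (mul_cancel_left_mem_nonZeroDivisors hxreg).1 (congrArg Subtype.val h)
  have hp : Function.Surjective p := Submodule.mkQ_surjective _
  have hκp : Function.Exact κ p := fun y =>
    (Submodule.Quotient.mk_eq_zero _).trans (coe_mem_span_singleton_mul_iff ω x y)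
  have hC : InjDimLE d (qmod R ω (Ideal.span {x} * ω)) := InjDimLE.cokernel hκ hp hκp hW hW
  have hull_le := length_residueExt_hull_le_approx hR hY₁ hX₁ hY₂ hX₂ hC hj hq hjq hι₁ hπ₁ hιπ₁
    hι₂ hπ₂ hιπ₂ (residueExtMap_comp_eq_zero hR he₀ hW hc hY₂ hX₂ hmin₂)
  have approx_le := length_residueExt_approx_le_hull_prod hR hY₁ hX₁ hY₂ hX₂ hC hj hq hjq
    hι₁ hπ₁ hιπ₁ hι₂ hπ₂ hιπ₂ hW hWd hκ hp hκp
    (residueExtMap_comp_eq_zero hR he₀ hW hc hY₁ hX₁ hmin₁)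
  have prod_le := length_residueExt_prod_le (d := d) (Y := W) (X := X₂)
  rw [Module.length_eq_one R (ResidueExt d W)] at prod_le
  refine ⟨?_, fun ⟨⟨f⟩, ⟨g⟩⟩ => ?_⟩
  · obtain heq | hlt := hull_le.1.eq_or_lt
    · exact .inl ((hull_le.2 heq).map LinearEquiv.symm)
    · refine .inr (approx_le.2 (approx_le.1.antisymm (prod_le.trans ?_)))
      rw [add_comm]
      exact Order.add_one_le_of_lt hlt
  · let h := f.symm ≪≫ₗ g
    have hinj := OrzechProperty.injective_of_surjective_endomorphism
      (LinearMap.snd R ω X₂ ∘ₗ h.toLinearMap) (Prod.snd_surjective.comp h.surjective)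
    refine not_subsingleton W ⟨fun a b => ?_⟩
    have := @hinj (h.symm (a, 0)) (h.symm (b, 0)) (by simp)
    exact congrArg Prod.fst (h.symm.injective this)

end
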